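/- arXiv:2212.02191 — 3 statements merged into one kernel-verified Lean document; each statement's English description precedes it below -/
import Mathlib

section
/- Let f_1, …, f_N : ℝ^d → ℝ be convex and differentiable, each with β-Lipschitz gradient, let f = (1/N)·Σ_{i=1}^N f_i, and let x★ be a global minimizer of f. Then for every x ∈ ℝ^d: (1/N)·Σ_{i=1}^N ‖∇f_i(x) − ∇f_i(x★)‖² ≤ 2β·(f(x) − f(x★)). -/
open MeasureTheory

noncomputable section

section GradientInequalities

variable {E : Type*} [NormedAddCommGroup E] [InnerProductSpace ℝ E] [CompleteSpace E]

lemma hasDerivAt_comp_line {f : E → ℝ} (hf : Differentiable ℝ f) (x v : E) (t : ℝ) :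
    HasDerivAt (fun s : ℝ => f (x + s • v)) (inner ℝ (gradient f (x + t • v)) v) t := by
  have hline : HasDerivAt (fun s : ℝ => x + s • v) v t := by
    simpa using ((hasDerivAt_id t).smul_const v).const_add x
  have h := (hf (x + t • v)).hasGradientAt.hasFDerivAt.comp_hasDerivAt t hline
  simpa [Function.comp_def] using h

/-- The first-order characterization of convexity. -/
lemma ConvexOn.add_inner_gradient_le {f : E → ℝ} (hconv : ConvexOn ℝ Set.univ f)
    (hf : Differentiable ℝ f) (x v : E) :
    f x + inner ℝ (gradient f x) v ≤ f (x + v) := by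
  have hc : ConvexOn ℝ Set.univ (fun s : ℝ => f (x + s • v)) := by
    refine ⟨convex_univ, fun a _ b _ p q hp hq hpq => ?_⟩
    have h := hconv.2 (Set.mem_univ (x + a • v)) (Set.mem_univ (x + b • v)) hp hq hpq
    have hx : p • (x + a • v) + q • (x + b • v) = x + (p • a + q • b) • v := by
      rw [← eq_sub_iff_add_eq] at hpq
      subst hpq
      simp only [smul_eq_mul]
      module
    rwa [hx] at h
  have h := hc.le_slope_of_hasDerivAt (Set.mem_univ 0) (Set.mem_univ 1) one_pos
    (hasDerivAt_comp_line hf x v 0)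
  simp only [slope_def_field, zero_smul, add_zero, one_smul, sub_zero, div_one] at h
  linarith

/-- The descent lemma: a function with `β`-Lipschitz gradient lies below its quadratic
upper model. -/
lemma le_add_inner_gradient_add_sq {f : E → ℝ} (hf : Differentiable ℝ f) {β : ℝ}
    (hsmooth : ∀ x y, ‖gradient f x - gradient f y‖ ≤ β * ‖x - y‖) (x v : E) :
    f (x + v) ≤ f x + inner ℝ (gradient f x) v + β / 2 * ‖v‖ ^ 2 := by
  have hder : ∀ t : ℝ, HasDerivAt
      (fun s : ℝ => f (x + s • v) - s * inner ℝ (gradient f x) v - s ^ 2 * (β / 2 * ‖v‖ ^ 2))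
      (inner ℝ (gradient f (x + t • v)) v - inner ℝ (gradient f x) v
        - 2 * t * (β / 2 * ‖v‖ ^ 2)) t := fun t => by
    simpa using ((hasDerivAt_comp_line hf x v t).fun_sub
      ((hasDerivAt_id t).mul_const (inner ℝ (gradient f x) v))).fun_sub
      ((hasDerivAt_pow 2 t).mul_const (β / 2 * ‖v‖ ^ 2))
  have hanti := antitoneOn_of_deriv_nonpos (convex_Icc (0 : ℝ) 1)
    (fun t _ => (hder t).continuousAt.continuousWithinAt)
    (fun t _ => (hder t).differentiableAt.differentiableWithinAt) (fun t ht => by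
      rw [interior_Icc] at ht
      rw [(hder t).deriv, ← inner_sub_left]
      have h₁ := real_inner_le_norm (gradient f (x + t • v) - gradient f x) v
      have h₂ := mul_le_mul_of_nonneg_right (hsmooth (x + t • v) x) (norm_nonneg v)
      rw [add_sub_cancel_left, norm_smul, Real.norm_of_nonneg ht.1.le] at h₂
      linarith)
  have h := hanti (Set.left_mem_Icc.2 zero_le_one) (Set.right_mem_Icc.2 zero_le_one) zero_le_one
  simp only [zero_smul, one_smul, add_zero] at h
  linarith

/-- For a convex function with `β`-Lipschitz gradient, the squared gradient deviation is bounded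
by `2β` times the Bregman divergence. -/
lemma ConvexOn.sq_norm_gradient_sub_le {f : E → ℝ} (hconv : ConvexOn ℝ Set.univ f)
    (hf : Differentiable ℝ f) {β : ℝ} (hβ : 0 ≤ β)
    (hsmooth : ∀ x y, ‖gradient f x - gradient f y‖ ≤ β * ‖x - y‖) (x y : E) :
    ‖gradient f x - gradient f y‖ ^ 2 ≤
      2 * β * (f x - f y - inner ℝ (gradient f y) (x - y)) := by
  rcases hβ.eq_or_lt with rfl | hpos
  · have h := hsmooth x y
    rw [zero_mul] at h
    simp [le_antisymm h (norm_nonneg _)]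
  · set Δ := gradient f x - gradient f y with hΔ
    have h₁ := le_add_inner_gradient_add_sq hf hsmooth x (-(β⁻¹ • Δ))
    have h₂ := hconv.add_inner_gradient_le hf y (x - y + -(β⁻¹ • Δ))
    have hz : y + (x - y + -(β⁻¹ • Δ)) = x + -(β⁻¹ • Δ) := by abel
    rw [hz, inner_add_right, inner_neg_right, real_inner_smul_right] at h₂
    rw [inner_neg_right, real_inner_smul_right, norm_neg, norm_smul,
      Real.norm_of_nonneg (inv_nonneg.2 hβ)] at h₁
    have h₃ : inner ℝ (gradient f x) Δ - inner ℝ (gradient f y) Δ = ‖Δ‖ ^ 2 := by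
      rw [← inner_sub_left, ← hΔ, real_inner_self_eq_norm_sq]
    have h₄ : β⁻¹ * ‖Δ‖ ^ 2 - β / 2 * (β⁻¹ * ‖Δ‖) ^ 2 ≤
        f x - f y - inner ℝ (gradient f y) (x - y) := by
      rw [← h₃, mul_sub]
      linarith
    calc ‖Δ‖ ^ 2 = 2 * β * (β⁻¹ * ‖Δ‖ ^ 2 - β / 2 * (β⁻¹ * ‖Δ‖) ^ 2) := by
          field_simp
          ring
      _ ≤ _ := by gcongr

/-- At a minimizer of a finite sum, the gradients of the summands cancel in every direction. -/
lemma sum_inner_gradient_eq_zero {ι : Type*} [Fintype ι] {f : ι → E → ℝ}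
    (hf : ∀ i, Differentiable ℝ (f i)) {x₀ : E} (hmin : ∀ x, ∑ i, f i x₀ ≤ ∑ i, f i x) (v : E) :
    ∑ i, inner ℝ (gradient (f i) x₀) v = 0 := by
  have hder : HasDerivAt (fun s : ℝ => ∑ i, f i (x₀ + s • v))
      (∑ i, inner ℝ (gradient (f i) x₀) v) 0 := by
    simpa using HasDerivAt.fun_sum (u := Finset.univ)
      fun i _ => hasDerivAt_comp_line (hf i) x₀ v 0
  refine IsLocalMin.hasDerivAt_eq_zero (Filter.Eventually.of_forall fun s => ?_) hder
  simpa using hmin (x₀ + s • v)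

end GradientInequalities

/-- for convex `β`-smooth functions `f_i` with average `f` minimized at
`x★`, the average squared gradient deviation from `x★` is bounded by
`2β·(f(x) − f(x★))`. -/
theorem avg_sq_grad_deviation_le {d N : ℕ} (hN : 1 ≤ N)
    (f : Fin N → EuclideanSpace ℝ (Fin d) → ℝ)
    (hdiff : ∀ i, Differentiable ℝ (f i))
    (hconv : ∀ i, ConvexOn ℝ Set.univ (f i))
    (β : ℝ) (hβ : 0 ≤ β)
    (hsmooth : ∀ i, ∀ x y : EuclideanSpace ℝ (Fin d),
      ‖gradient (f i) x - gradient (f i) y‖ ≤ β * ‖x - y‖)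
    (xstar : EuclideanSpace ℝ (Fin d))
    (hmin : ∀ x : EuclideanSpace ℝ (Fin d),
      (N : ℝ)⁻¹ * ∑ i : Fin N, f i xstar ≤ (N : ℝ)⁻¹ * ∑ i : Fin N, f i x) :
    ∀ x : EuclideanSpace ℝ (Fin d),
      (N : ℝ)⁻¹ * ∑ i : Fin N, ‖gradient (f i) x - gradient (f i) xstar‖ ^ 2
        ≤ 2 * β * ((N : ℝ)⁻¹ * ∑ i : Fin N, f i x
            - (N : ℝ)⁻¹ * ∑ i : Fin N, f i xstar) := by
  intro x
  have hN' : (0 : ℝ) < (N : ℝ)⁻¹ := by positivity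
  have hzero := sum_inner_gradient_eq_zero hdiff
    (fun z => le_of_mul_le_mul_left (hmin z) hN') (x - xstar)
  have hsum := Finset.sum_le_sum fun i (_ : i ∈ Finset.univ) =>
    (hconv i).sq_norm_gradient_sub_le (hdiff i) hβ (hsmooth i) x xstar
  rw [← Finset.mul_sum, Finset.sum_sub_distrib, Finset.sum_sub_distrib, hzero, sub_zero] at hsum
  calc _ ≤ (N : ℝ)⁻¹ * (2 * β * (∑ i, f i x - ∑ i, f i xstar)) := by gcongr
    _ = _ := by ring

end
end

section
/- Contractive mapping of a gradient step: let h : ℝ^d → ℝ be differentiable with β-Lipschitz gradient and μ-strongly convex with μ ≥ 0, and let 0 ≤ η ≤ 1/β. Then for all x, y ∈ ℝ^d: ‖x − η·∇h(x) − y + η·∇h(y)‖² ≤ (1 − μη)·‖x − y‖². -/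
open MeasureTheory

noncomputable section

open scoped InnerProductSpace

section Gradient

variable {E : Type*} [NormedAddCommGroup E] [InnerProductSpace ℝ E] [CompleteSpace E]

lemma hasDerivAt_comp_line_gradient {f : E → ℝ} (hf : Differentiable ℝ f) (x v : E) (t : ℝ) :
    HasDerivAt (fun s : ℝ => f (x + s • v)) ⟪gradient f (x + t • v), v⟫_ℝ t := by
  have hline : HasDerivAt (fun s : ℝ => x + s • v) v t := by
    simpa using ((hasDerivAt_id t).smul_const v).const_add x
  rw [inner_gradient_left]
  exact (hf (x + t • v)).hasFDerivAt.comp_hasDerivAt t hline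

/-- First-order lower bound for a differentiable `m`-strongly convex function. -/
lemma StrongConvexOn.add_inner_gradient_le {f : E → ℝ} {m : ℝ}
    (hf : Differentiable ℝ f) (hconv : StrongConvexOn Set.univ m f) (x y : E) :
    f x + ⟪gradient f x, y - x⟫_ℝ + m / 2 * ‖y - x‖ ^ 2 ≤ f y := by
  have hline := (strongConvexOn_iff_convex.mp hconv).comp_affineMap (AffineMap.lineMap x y)
  have hderiv := (hasDerivAt_comp_line_gradient hf x (y - x) 0).sub
    (((((hasDerivAt_id (0 : ℝ)).smul_const (y - x)).const_add x).norm_sq).const_mul (m / 2))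
  have hslope := hline.le_slope_of_hasDerivAt (x := 0) (y := 1) (by simp) (by simp) one_pos
    (hderiv.congr_of_eventuallyEq (.of_forall fun t => by
      simp [AffineMap.lineMap_apply, add_comm]))
  have hnorm : ‖y‖ ^ 2 = ‖x‖ ^ 2 + 2 * ⟪x, y - x⟫_ℝ + ‖y - x‖ ^ 2 := by
    rw [← norm_add_sq_real, add_sub_cancel]
  simp [slope_def_field, -inner_gradient_left] at hslope
  rw [hnorm] at hslope
  linarith

/-- The descent lemma: a quadratic upper bound for a function with Lipschitz gradient. -/
lemma le_add_inner_gradient_of_lipschitz {f : E → ℝ} {L : ℝ} (hf : Differentiable ℝ f)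
    (hL : ∀ x y, ‖gradient f x - gradient f y‖ ≤ L * ‖x - y‖) (x y : E) :
    f y ≤ f x + ⟪gradient f x, y - x⟫_ℝ + L / 2 * ‖y - x‖ ^ 2 := by
  set v := y - x with hv
  have hderiv (t : ℝ) : HasDerivAt
      (fun s : ℝ => f (x + s • v) - s * ⟪gradient f x, v⟫_ℝ - s ^ 2 * (L / 2 * ‖v‖ ^ 2))
      (⟪gradient f (x + t • v) - gradient f x, v⟫_ℝ - t * (L * ‖v‖ ^ 2)) t := by
    refine (((hasDerivAt_comp_line_gradient hf x v t).sub
      ((hasDerivAt_id t).mul_const ⟪gradient f x, v⟫_ℝ)).sub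
      ((hasDerivAt_pow 2 t).mul_const (L / 2 * ‖v‖ ^ 2))).congr_deriv ?_
    rw [inner_sub_left]
    push_cast
    ring
  have hanti : AntitoneOn
      (fun s : ℝ => f (x + s • v) - s * ⟪gradient f x, v⟫_ℝ - s ^ 2 * (L / 2 * ‖v‖ ^ 2))
      (Set.Icc 0 1) := by
    refine antitoneOn_of_deriv_nonpos (convex_Icc 0 1)
      (fun t _ => (hderiv t).continuousAt.continuousWithinAt)
      (fun t _ => (hderiv t).differentiableAt.differentiableWithinAt) fun t ht => ?_
    rw [interior_Icc] at ht
    rw [(hderiv t).deriv, sub_nonpos]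
    calc ⟪gradient f (x + t • v) - gradient f x, v⟫_ℝ
        ≤ ‖gradient f (x + t • v) - gradient f x‖ * ‖v‖ := real_inner_le_norm _ _
      _ ≤ L * ‖x + t • v - x‖ * ‖v‖ := by gcongr; exact hL _ _
      _ = t * (L * ‖v‖ ^ 2) := by
        rw [add_sub_cancel_left, norm_smul, Real.norm_of_nonneg ht.1.le]
        ring
  have hle := hanti (Set.left_mem_Icc.2 zero_le_one) (Set.right_mem_Icc.2 zero_le_one) zero_le_one
  have hxy : x + v = y := by simp [hv]
  simp [hxy, -inner_gradient_left] at hle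
  linarith

/-- Co-coercivity of the gradient of a convex function with Lipschitz gradient. -/
lemma mul_norm_gradient_sub_sq_le_inner {f : E → ℝ} {L η : ℝ} (hf : Differentiable ℝ f)
    (hconv : ConvexOn ℝ Set.univ f)
    (hL : ∀ x y, ‖gradient f x - gradient f y‖ ≤ L * ‖x - y‖)
    (hη : 0 ≤ η) (hηL : L * η ≤ 1) (x y : E) :
    η * ‖gradient f x - gradient f y‖ ^ 2 ≤ ⟪gradient f x - gradient f y, x - y⟫_ℝ := by
  have bregman (a b : E) : f a + ⟪gradient f a, b - a⟫_ℝ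
      + η / 2 * ‖gradient f b - gradient f a‖ ^ 2 ≤ f b := by
    set g := gradient f b - gradient f a with hg
    have hlow := (strongConvexOn_zero.mpr hconv).add_inner_gradient_le hf a (b - η • g)
    have hupp := le_add_inner_gradient_of_lipschitz hf hL b (b - η • g)
    have hinner : ⟪gradient f b, g⟫_ℝ - ⟪gradient f a, g⟫_ℝ = ‖g‖ ^ 2 := by
      rw [← inner_sub_left, ← hg, real_inner_self_eq_norm_sq]
    have hquad : L * η * (η * ‖g‖ ^ 2) ≤ 1 * (η * ‖g‖ ^ 2) := by gcongr
    rw [sub_right_comm, inner_sub_right, real_inner_smul_right] at hlow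
    rw [sub_sub_cancel_left, inner_neg_right, real_inner_smul_right, norm_neg, norm_smul,
      mul_pow, Real.norm_eq_abs, sq_abs] at hupp
    linear_combination hlow + hupp + hquad / 2 - η * hinner
  have hxy := bregman x y
  have hyx := bregman y x
  rw [norm_sub_rev, ← neg_sub x y, inner_neg_right] at hxy
  rw [inner_sub_left]
  linarith

end Gradient

/-- contractive mapping of a gradient step: for a `β`-smooth,
`μ`-strongly convex function `h` and step size `0 ≤ η ≤ 1/β`,
`‖x − η∇h(x) − y + η∇h(y)‖² ≤ (1 − μη)‖x − y‖²`. -/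
theorem gradient_step_contractive {d : ℕ}
    (h : EuclideanSpace ℝ (Fin d) → ℝ) (hdiff : Differentiable ℝ h)
    (β μ' : ℝ) (hβ : 0 ≤ β) (hμ : 0 ≤ μ')
    (hsmooth : ∀ x y : EuclideanSpace ℝ (Fin d),
      ‖gradient h x - gradient h y‖ ≤ β * ‖x - y‖)
    (hsc : ConvexOn ℝ Set.univ (fun x : EuclideanSpace ℝ (Fin d) =>
      h x - μ' / 2 * ‖x‖ ^ 2))
    (η : ℝ) (hη0 : 0 ≤ η) (hη : η ≤ 1 / β) :
    ∀ x y : EuclideanSpace ℝ (Fin d),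
      ‖x - η • gradient h x - y + η • gradient h y‖ ^ 2
        ≤ (1 - μ' * η) * ‖x - y‖ ^ 2 := by
  intro x y
  have hηβ : β * η ≤ 1 := by
    calc β * η ≤ β * (1 / β) := by gcongr
      _ ≤ 1 := by simpa using mul_inv_le_one
  have hstrong : StrongConvexOn Set.univ μ' h := strongConvexOn_iff_convex.mpr hsc
  have hconv : ConvexOn ℝ Set.univ h := strongConvexOn_zero.mp (hstrong.mono hμ)
  have hcoco := mul_norm_gradient_sub_sq_le_inner hdiff hconv hsmooth hη0 hηβ x y
  have hmono : μ' * ‖x - y‖ ^ 2 ≤ ⟪gradient h x - gradient h y, x - y⟫_ℝ := by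
    have hxy := hstrong.add_inner_gradient_le hdiff x y
    have hyx := hstrong.add_inner_gradient_le hdiff y x
    rw [norm_sub_rev, ← neg_sub x y, inner_neg_right] at hxy
    rw [inner_sub_left]
    linarith
  have hstep : x - η • gradient h x - y + η • gradient h y
      = (x - y) - η • (gradient h x - gradient h y) := by module
  rw [hstep, norm_sub_sq_real, real_inner_smul_right, real_inner_comm, norm_smul, mul_pow,
    Real.norm_eq_abs, sq_abs]
  linear_combination η * hcoco + η * hmono

end
end

section
/- Step-size tuning: for any r0 > 0, b ≥ 0, e ≥ 0, γ > 0 and any natural number T, there exists a step size η with 0 < η ≤ 1/γ such that r0/(η(T+1)) + b·η + e·η² ≤ 2·(b·r0/(T+1))^{1/2} + 2·e^{1/3}·(r0/(T+1))^{2/3} + γ·r0/(T+1). -/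
noncomputable section

/-- With `M = s + t + γ`, the step size `1 / M` balances the three terms of `a / η + b η + e η²`,
where `b = a s²` and `e = a t³`. -/
theorem step_size_bound {a s t γ : ℝ} (ha : 0 ≤ a) (hs : 0 ≤ s) (ht : 0 ≤ t) (hγ : 0 < γ) :
    a / (1 / (s + t + γ)) + a * s ^ 2 * (1 / (s + t + γ)) + a * t ^ 3 * (1 / (s + t + γ)) ^ 2
      ≤ 2 * (a * s) + 2 * (a * t) + γ * a := by
  have hM : 0 < s + t + γ := by positivity
  have h₁ : a * s ^ 2 * (1 / (s + t + γ)) ≤ a * s := by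
    rw [mul_one_div, div_le_iff₀ hM, sq, ← mul_assoc]
    gcongr
    linarith
  have h₂ : a * t ^ 3 * (1 / (s + t + γ)) ^ 2 ≤ a * t := by
    rw [one_div, inv_pow, ← div_eq_mul_inv, div_le_iff₀ (by positivity), pow_succ', ← mul_assoc]
    gcongr
    linarith
  rw [div_div_eq_mul_div, div_one]
  linarith

/-- step-size tuning: for any `r0 > 0`, `b ≥ 0`, `e ≥ 0`, `γ > 0` and
natural number `T`, there is a step size `0 < η ≤ 1/γ` with
`r0/(η(T+1)) + bη + eη² ≤ 2√(b·r0/(T+1)) + 2e^{1/3}(r0/(T+1))^{2/3} + γ·r0/(T+1)`. -/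
theorem step_size_tuning (r0 b e γ : ℝ) (hr0 : 0 < r0) (hb : 0 ≤ b) (he : 0 ≤ e)
    (hγ : 0 < γ) (T : ℕ) :
    ∃ η : ℝ, 0 < η ∧ η ≤ 1 / γ ∧
      r0 / (η * ((T : ℝ) + 1)) + b * η + e * η ^ 2
        ≤ 2 * (b * r0 / ((T : ℝ) + 1)) ^ ((1 : ℝ) / 2)
          + 2 * e ^ ((1 : ℝ) / 3) * (r0 / ((T : ℝ) + 1)) ^ ((2 : ℝ) / 3)
          + γ * r0 / ((T : ℝ) + 1) := by
  obtain ⟨a, ha_def⟩ : ∃ a : ℝ, a = r0 / ((T : ℝ) + 1) := ⟨_, rfl⟩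
  have ha : 0 < a := by rw [ha_def]; positivity
  obtain ⟨s, hs, rfl⟩ : ∃ s : ℝ, 0 ≤ s ∧ b = a * s ^ 2 :=
    ⟨√(b / a), Real.sqrt_nonneg _, by rw [Real.sq_sqrt (by positivity)]; field_simp⟩
  obtain ⟨t, ht, rfl⟩ : ∃ t : ℝ, 0 ≤ t ∧ e = a * t ^ 3 := by
    refine ⟨(e / a) ^ ((1 : ℝ) / 3), by positivity, ?_⟩
    rw [← Real.rpow_mul_natCast (by positivity)]
    norm_num
    field_simp
  have hsqrt : (a * s ^ 2 * a) ^ ((1 : ℝ) / 2) = a * s := by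
    rw [← Real.sqrt_eq_rpow, show a * s ^ 2 * a = (a * s) ^ 2 by ring,
      Real.sqrt_sq (by positivity)]
  have hcbrt : (a * t ^ 3) ^ ((1 : ℝ) / 3) * a ^ ((2 : ℝ) / 3) = a * t := by
    rw [Real.mul_rpow ha.le (by positivity), ← Real.rpow_natCast_mul ht, mul_right_comm,
      ← Real.rpow_add ha]
    norm_num
  refine ⟨1 / (s + t + γ), by positivity, one_div_le_one_div_of_le hγ (by linarith), ?_⟩
  rw [mul_comm (1 / _) ((T : ℝ) + 1), ← div_div, mul_div_assoc (a * s ^ 2), mul_div_assoc γ,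
    ← ha_def, hsqrt, mul_assoc 2 (_ ^ _) (_ ^ _), hcbrt]
  exact step_size_bound ha.le hs ht hγ

end
end
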